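/- Fix a real η > 0, an integer α ≥ 1, and a real σ ≤ 0. Then ∫_0^∞ [∫_0^∞ P_η(ξ)·exp(−√β·τ_η(ξ) − iσβ) dξ] dβ = ∫_0^∞ [∫_0^∞ P_η(ξ)·exp(−√β·τ_η(ξ) − iσβ) dβ] dξ, both iterated improper integrals existing. -/

import Mathlib

open scoped Real Topology
open Filter

/-- The error function `erf z = (2/√π) ∫_0^z e^{-t²} dt`, along the straight
segment from `0` to `z`. -/
noncomputable def cerf (z : ℂ) : ℂ :=
  2 / Real.sqrt Real.pi * (z * ∫ t in (0:ℝ)..1, Complex.exp (-(t * z) ^ 2))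

/-- `w(z) = e^{-z²} erfc(-iz)`. -/
noncomputable def wfun (z : ℂ) : ℂ :=
  Complex.exp (-z ^ 2) * (1 - cerf (-Complex.I * z))

/-- `P_η(ξ)`. -/
noncomputable def Pfun (a : ℕ) (η ξ : ℝ) : ℂ :=
  (Real.sqrt (Real.pi * η) : ℂ)⁻¹ * Complex.exp (Complex.I * (ξ ^ 2 / (4 * η) - Real.pi / 4))
  + ((a : ℂ) - 1) / (Real.sqrt Real.pi : ℂ) *
      Complex.exp (Complex.I * (Real.pi / 4 - ξ ^ 2 / 4))

/-- `τ_η(ξ)`. -/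
noncomputable def taufun (a : ℕ) (η ξ : ℝ) : ℂ :=
  2 * Real.sqrt η / Real.sqrt Real.pi * Complex.exp (Complex.I * (Real.pi / 4 + ξ ^ 2 / (4 * η)))
  + ξ * cerf (Complex.exp (-(Complex.I * (Real.pi / 4))) * ξ / (2 * Real.sqrt η))
  + 2 * ((a : ℂ) - 1) / Real.sqrt Real.pi *
      Complex.exp (-(Complex.I * (Real.pi / 4 + ξ ^ 2 / 4)))
  + ξ * ((a : ℂ) - 1) * cerf (Complex.exp (Complex.I * (Real.pi / 4)) * ξ / 2)

lemma cerf_mul_ofReal (k : ℂ) (x : ℝ) :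
    cerf (k * x) = 2 / Real.sqrt Real.pi * (k * ∫ s in (0:ℝ)..x, Complex.exp (-(k * s) ^ 2)) := by
  have h := intervalIntegral.smul_integral_comp_mul_left (a := 0) (b := 1)
    (fun s : ℝ => Complex.exp (-(k * s) ^ 2)) x
  simp only [mul_zero, mul_one] at h
  rw [cerf, ← h, Complex.real_smul, mul_assoc k]
  congr 3
  refine intervalIntegral.integral_congr fun t _ => ?_
  push_cast
  ring_nf

lemma hasDerivAt_cerf_mul_ofReal (k : ℂ) (x : ℝ) :
    HasDerivAt (fun x : ℝ => cerf (k * x))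
      (2 / Real.sqrt Real.pi * (k * Complex.exp (-(k * x) ^ 2))) x := by
  simp only [cerf_mul_ofReal]
  have hc : Continuous fun s : ℝ => Complex.exp (-(k * s) ^ 2) := by fun_prop
  exact ((hc.integral_hasStrictDerivAt 0 x).hasDerivAt.const_mul k).const_mul _

lemma mul_integral_exp_neg_sq_eq_sub {A : ℂ → ℂ}
    (hA : ∀ z, HasDerivAt A (Complex.exp (-z ^ 2)) z) (z v : ℂ) (b : ℝ) :
    v * ∫ t in (0:ℝ)..b, Complex.exp (-(t * v + z) ^ 2) = A (b * v + z) - A z := by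
  have h : ∀ t : ℝ, HasDerivAt (fun t : ℝ => A (t * v + z))
      (Complex.exp (-(t * v + z) ^ 2) * v) t := fun t => by
    have h1 : HasDerivAt (fun t : ℝ => t * v + z) v t := by
      simpa using (Complex.ofRealCLM.hasDerivAt.mul_const v).add_const z
    exact (hA _).comp t h1
  have := intervalIntegral.integral_eq_sub_of_hasDerivAt (a := 0) (b := b)
    (fun t _ => h t) (Continuous.intervalIntegrable (by fun_prop) _ _)
  rw [intervalIntegral.integral_mul_const] at this
  rw [mul_comm, this]
  simp

lemma norm_exp_neg_add_sq_le {z : ℂ} (hz : 0 ≤ (z ^ 2).re) (s : ℝ) :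
    ‖Complex.exp (-(s + z) ^ 2)‖ ≤ Real.exp (-s ^ 2 - 2 * z.re * s) := by
  rw [Complex.norm_exp, Real.exp_le_exp]
  simp [pow_two] at *
  nlinarith

/-- Domination of `erfc z = (2/√π) ∫_0^∞ e^{-(s+z)²} ds` when `Re z ≥ 0` and `Re z² ≥ 0`. -/
lemma norm_one_sub_cerf_le {z : ℂ} (hz : 0 ≤ z.re) (hz2 : 0 ≤ (z ^ 2).re) {g : ℝ → ℝ}
    (hg : MeasureTheory.IntegrableOn g (Set.Ioi 0))
    (hb : ∀ s : ℝ, 0 < s → Real.exp (-s ^ 2 - 2 * z.re * s) ≤ g s) :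
    ‖1 - cerf z‖ ≤ 2 / Real.sqrt Real.pi * ∫ s in Set.Ioi (0:ℝ), g s := by
  obtain ⟨A, hA'⟩ := Differentiable.isExactOn_univ
    (f := fun z : ℂ => Complex.exp (-z ^ 2)) (by fun_prop)
  have hA : ∀ z, HasDerivAt A (Complex.exp (-z ^ 2)) z := fun z => hA' z trivial
  have hπ : (0:ℝ) < Real.sqrt Real.pi := Real.sqrt_pos.2 Real.pi_pos
  have hπ' : (Real.sqrt Real.pi : ℂ) ≠ 0 := by exact_mod_cast hπ.ne'
  set R : ℝ → ℝ := fun N => ∫ s in (0:ℝ)..N, Real.exp (-1 * s ^ 2)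
  have hR : Tendsto R atTop (𝓝 (Real.sqrt Real.pi / 2)) := by
    have := MeasureTheory.intervalIntegral_tendsto_integral_Ioi 0
      (integrable_exp_neg_mul_sq one_pos).integrableOn tendsto_id
    rwa [integral_gaussian_Ioi, div_one] at this
  have hRA : ∀ N : ℝ, (R N : ℂ) = A N - A 0 := fun N => by
    have := mul_integral_exp_neg_sq_eq_sub hA 0 1 N
    simp only [mul_one, add_zero, one_mul] at this
    rw [← this, ← intervalIntegral.integral_ofReal]
    exact intervalIntegral.integral_congr fun t _ => by simp
  have hcz : (Real.sqrt Real.pi / 2 : ℂ) * cerf z = A z - A 0 := by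
    have := mul_integral_exp_neg_sq_eq_sub hA 0 z 1
    simp only [Complex.ofReal_one, add_zero, one_mul] at this
    rw [← this, cerf]
    field_simp
  have key : ∀ N : ℝ, 0 ≤ N → Real.sqrt Real.pi / 2 * ‖1 - cerf z‖ ≤
      |Real.sqrt Real.pi / 2 - R N| + (∫ s in Set.Ioi (0:ℝ), g s)
        + ‖z‖ * Real.exp (-N ^ 2) := fun N hN => by
    have h1 := mul_integral_exp_neg_sq_eq_sub hA z 1 N
    have h2 := mul_integral_exp_neg_sq_eq_sub hA N z 1
    simp only [mul_one, one_mul, Complex.ofReal_one] at h1 h2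
    have e : (Real.sqrt Real.pi / 2 : ℂ) * (1 - cerf z) = ((Real.sqrt Real.pi / 2 - R N : ℝ) : ℂ)
        + (∫ t in (0:ℝ)..N, Complex.exp (-(t + z) ^ 2))
        - z * ∫ t in (0:ℝ)..1, Complex.exp (-(t * z + N) ^ 2) := by
      rw [h1, h2, mul_sub, hcz]
      push_cast
      rw [hRA, add_comm z]
      ring
    have b1 : ‖∫ t in (0:ℝ)..N, Complex.exp (-(t + z) ^ 2)‖ ≤ ∫ s in Set.Ioi (0:ℝ), g s := by
      refine (intervalIntegral.norm_integral_le_of_norm_le hN (g := g) ?_ ?_).trans ?_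
      · exact .of_forall fun t ht => (norm_exp_neg_add_sq_le hz2 t).trans (hb t ht.1)
      · rw [intervalIntegrable_iff_integrableOn_Ioc_of_le hN]
        exact hg.mono_set Set.Ioc_subset_Ioi_self
      · rw [intervalIntegral.integral_of_le hN]
        refine MeasureTheory.setIntegral_mono_set hg ?_ Set.Ioc_subset_Ioi_self.eventuallyLE
        refine (MeasureTheory.ae_restrict_iff' measurableSet_Ioi).2 (.of_forall fun s hs => ?_)
        exact (Real.exp_pos _).le.trans (hb s hs)
    have b2 : ‖∫ t in (0:ℝ)..1, Complex.exp (-(t * z + N) ^ 2)‖ ≤ Real.exp (-N ^ 2) := by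
      refine (intervalIntegral.norm_integral_le_of_norm_le_const fun t ht => ?_).trans_eq
        (by simp : Real.exp (-N ^ 2) * |(1:ℝ) - 0| = _)
      rw [Set.uIoc_of_le zero_le_one] at ht
      have h : 0 ≤ ((t * z) ^ 2).re := by
        rw [mul_pow, ← Complex.ofReal_pow, Complex.re_ofReal_mul]
        positivity
      rw [add_comm]
      refine (norm_exp_neg_add_sq_le h N).trans (Real.exp_le_exp.2 ?_)
      have : 0 ≤ (t * z).re := by
        rw [Complex.re_ofReal_mul]
        exact mul_nonneg ht.1.le hz
      nlinarith [mul_nonneg this hN]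
    have e' : Real.sqrt Real.pi / 2 * ‖1 - cerf z‖
        = ‖(Real.sqrt Real.pi / 2 : ℂ) * (1 - cerf z)‖ := by
      rw [norm_mul]
      congr 1
      rw [norm_div, Complex.norm_real, Real.norm_of_nonneg hπ.le]
      simp
    rw [e', e]
    refine (norm_sub_le _ _).trans (add_le_add ((norm_add_le _ _).trans (add_le_add ?_ b1)) ?_)
    · rw [Complex.norm_real, Real.norm_eq_abs]
    · rw [norm_mul]
      gcongr
  have lim : Tendsto (fun N : ℝ => |Real.sqrt Real.pi / 2 - R N| + (∫ s in Set.Ioi (0:ℝ), g s)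
      + ‖z‖ * Real.exp (-N ^ 2)) atTop (𝓝 (∫ s in Set.Ioi (0:ℝ), g s)) := by
    have h1 : Tendsto (fun N : ℝ => Real.exp (-N ^ 2)) atTop (𝓝 0) :=
      Real.tendsto_exp_neg_atTop_nhds_zero.comp (tendsto_pow_atTop two_ne_zero)
    simpa using (((tendsto_const_nhds (x := Real.sqrt Real.pi / 2)).sub hR).abs.add_const
      (∫ s in Set.Ioi (0:ℝ), g s)).add (h1.const_mul ‖z‖)
  have := ge_of_tendsto lim ((eventually_ge_atTop 0).mono key)
  rw [div_mul_eq_mul_div, le_div_iff₀ hπ]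
  linarith

lemma norm_one_sub_cerf_le_one {z : ℂ} (hz : 0 ≤ z.re) (hz2 : 0 ≤ (z ^ 2).re) :
    ‖1 - cerf z‖ ≤ 1 := by
  refine (norm_one_sub_cerf_le hz hz2 (integrable_exp_neg_mul_sq one_pos).integrableOn
    fun s hs => Real.exp_le_exp.2 ?_).trans_eq ?_
  · nlinarith [mul_nonneg hz hs.le]
  · rw [integral_gaussian_Ioi, div_one]
    have : Real.sqrt Real.pi ≠ 0 := (Real.sqrt_pos.2 Real.pi_pos).ne'
    field_simp

lemma norm_one_sub_cerf_le_inv {z : ℂ} (hz : 0 < z.re) (hz2 : 0 ≤ (z ^ 2).re) :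
    ‖1 - cerf z‖ ≤ (Real.sqrt Real.pi)⁻¹ * (z.re)⁻¹ := by
  refine (norm_one_sub_cerf_le hz.le hz2
    (integrableOn_exp_mul_Ioi (a := -(2 * z.re)) (by linarith) 0)
    fun s hs => Real.exp_le_exp.2 ?_).trans_eq ?_
  · nlinarith [sq_nonneg s]
  · rw [integral_exp_mul_Ioi (by linarith)]
    simp only [mul_zero, Real.exp_zero]
    field_simp

lemma tendsto_cerf_mul_ofReal_atTop {k : ℂ} (hk : 0 < k.re) (hk2 : 0 ≤ (k ^ 2).re) :
    Tendsto (fun x : ℝ => cerf (k * x)) atTop (𝓝 1) := by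
  rw [tendsto_iff_norm_sub_tendsto_zero]
  have h : Tendsto (fun x : ℝ => (Real.sqrt Real.pi)⁻¹ * (k.re * x)⁻¹) atTop (𝓝 0) := by
    simpa using (tendsto_inv_atTop_zero.comp
      (tendsto_id.const_mul_atTop hk)).const_mul (Real.sqrt Real.pi)⁻¹
  refine squeeze_zero' (.of_forall fun _ => norm_nonneg _) ?_ h
  filter_upwards [eventually_gt_atTop 0] with x hx
  rw [norm_sub_rev, ← Complex.re_mul_ofReal]
  refine norm_one_sub_cerf_le_inv ?_ ?_
  · rw [Complex.re_mul_ofReal]; positivity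
  · rw [mul_pow, ← Complex.ofReal_pow, Complex.re_mul_ofReal]; positivity

lemma cerf_mul_ofReal_re_nonneg {k : ℂ} (hk : 0 ≤ k.re) (hk2 : 0 ≤ (k ^ 2).re) {x : ℝ}
    (hx : 0 ≤ x) : 0 ≤ (cerf (k * x)).re := by
  have h : ‖1 - cerf (k * x)‖ ≤ 1 := by
    refine norm_one_sub_cerf_le_one ?_ ?_
    · rw [Complex.re_mul_ofReal]; positivity
    · rw [mul_pow, ← Complex.ofReal_pow, Complex.re_mul_ofReal]; positivity
  have := (Complex.re_le_norm _).trans h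
  simp only [Complex.sub_re, Complex.one_re] at this
  linarith

lemma exp_I_mul_pi_div_four :
    Complex.exp (Complex.I * (Real.pi / 4)) = (Real.sqrt 2 / 2 : ℝ) * (1 + Complex.I) := by
  have h : Complex.I * (Real.pi / 4) = ((Real.pi / 4 : ℝ) : ℂ) * Complex.I := by
    push_cast; ring
  rw [h, Complex.exp_mul_I, ← Complex.ofReal_cos, ← Complex.ofReal_sin, Real.cos_pi_div_four,
    Real.sin_pi_div_four]
  ring

lemma exp_neg_I_mul_pi_div_four :
    Complex.exp (-(Complex.I * (Real.pi / 4))) = (Real.sqrt 2 / 2 : ℝ) * (1 - Complex.I) := by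
  have h : -(Complex.I * (Real.pi / 4)) = ((-(Real.pi / 4) : ℝ) : ℂ) * Complex.I := by
    push_cast; ring
  rw [h, Complex.exp_mul_I, ← Complex.ofReal_cos, ← Complex.ofReal_sin, Real.cos_neg,
    Real.sin_neg, Real.cos_pi_div_four, Real.sin_pi_div_four]
  push_cast
  ring

/-- The direction of the argument of the first error function in `taufun`. -/
noncomputable def rayA (η : ℝ) : ℂ :=
  Complex.exp (-(Complex.I * (Real.pi / 4))) / (2 * Real.sqrt η)

/-- The direction of the argument of the second error function in `taufun`. -/
noncomputable def rayB : ℂ := Complex.exp (Complex.I * (Real.pi / 4)) / 2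

lemma sqrt_two_div_two_sq : ((Real.sqrt 2 / 2 : ℝ) : ℂ) ^ 2 = 1 / 2 := by
  rw [← Complex.ofReal_pow, div_pow, Real.sq_sqrt zero_le_two]
  norm_num

lemma rayA_sq {η : ℝ} (hη : 0 < η) : rayA η ^ 2 = -(Complex.I / (4 * η)) := by
  have hs : (Real.sqrt η : ℂ) ^ 2 = η := by
    rw [← Complex.ofReal_pow, Real.sq_sqrt hη.le]
  rw [rayA, exp_neg_I_mul_pi_div_four, div_pow, mul_pow, mul_pow, sqrt_two_div_two_sq, hs, sub_sq,
    Complex.I_sq]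
  ring

lemma rayB_sq : rayB ^ 2 = Complex.I / 4 := by
  rw [rayB, exp_I_mul_pi_div_four, div_pow, mul_pow, sqrt_two_div_two_sq, add_sq, Complex.I_sq]
  ring

lemma rayA_re_pos {η : ℝ} (hη : 0 < η) : 0 < (rayA η).re := by
  have h : rayA η = ((Real.sqrt 2 / 2 / (2 * Real.sqrt η) : ℝ) : ℂ) * (1 - Complex.I) := by
    rw [rayA, exp_neg_I_mul_pi_div_four]
    push_cast
    ring
  rw [h, Complex.re_ofReal_mul]
  simp only [Complex.sub_re, Complex.one_re, Complex.I_re, sub_zero, mul_one]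
  positivity

lemma rayB_re_pos : 0 < rayB.re := by
  have h : rayB = ((Real.sqrt 2 / 2 / 2 : ℝ) : ℂ) * (1 + Complex.I) := by
    rw [rayB, exp_I_mul_pi_div_four]
    push_cast
    ring
  rw [h, Complex.re_ofReal_mul]
  simp only [Complex.add_re, Complex.one_re, Complex.I_re, add_zero, mul_one]
  positivity

lemma rayA_sq_re {η : ℝ} (hη : 0 < η) : 0 ≤ (rayA η ^ 2).re := by
  have h : rayA η ^ 2 = ((-(1 / (4 * η)) : ℝ) : ℂ) * Complex.I := by
    rw [rayA_sq hη]
    push_cast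
    ring
  rw [h, Complex.re_ofReal_mul]
  simp

lemma rayB_sq_re : 0 ≤ (rayB ^ 2).re := by
  simp [rayB_sq]

/-- The derivative of `taufun a η`. -/
noncomputable def tauDeriv (a : ℕ) (η ξ : ℝ) : ℂ :=
  cerf (rayA η * ξ) + ((a : ℂ) - 1) * cerf (rayB * ξ)

lemma Pfun_eq {η : ℝ} (hη : 0 < η) (a : ℕ) (ξ : ℝ) :
    Pfun a η ξ = 2 / Real.sqrt Real.pi * (rayA η * Complex.exp (-(rayA η * ξ) ^ 2))
      + ((a : ℂ) - 1) *
        (2 / Real.sqrt Real.pi * (rayB * Complex.exp (-(rayB * ξ) ^ 2))) := by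
  have hπ : (Real.sqrt Real.pi : ℂ) ≠ 0 := by
    exact_mod_cast (Real.sqrt_pos.2 Real.pi_pos).ne'
  have hs : (Real.sqrt η : ℂ) ≠ 0 := by exact_mod_cast (Real.sqrt_pos.2 hη).ne'
  rw [mul_pow, mul_pow, rayA_sq hη, rayB_sq, rayA, rayB, Pfun, Real.sqrt_mul Real.pi_pos.le,
    Complex.ofReal_mul]
  have e1 : Complex.I * (ξ ^ 2 / (4 * η) - Real.pi / 4)
      = -(Complex.I * (Real.pi / 4)) + -(-(Complex.I / (4 * η)) * ξ ^ 2) := by ring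
  have e2 : Complex.I * (Real.pi / 4 - ξ ^ 2 / 4)
      = Complex.I * (Real.pi / 4) + -(Complex.I / 4 * ξ ^ 2) := by ring
  rw [e1, e2, Complex.exp_add, Complex.exp_add]
  field_simp

lemma taufun_eq {η : ℝ} (hη : 0 < η) (a : ℕ) (ξ : ℝ) :
    taufun a η ξ = 2 * Real.sqrt η / Real.sqrt Real.pi *
        (Complex.exp (Complex.I * (Real.pi / 4)) * Complex.exp (-(rayA η * ξ) ^ 2))
      + ξ * cerf (rayA η * ξ)
      + 2 * ((a : ℂ) - 1) / Real.sqrt Real.pi *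
        (Complex.exp (-(Complex.I * (Real.pi / 4))) * Complex.exp (-(rayB * ξ) ^ 2))
      + ξ * ((a : ℂ) - 1) * cerf (rayB * ξ) := by
  rw [taufun, ← Complex.exp_add, ← Complex.exp_add, mul_pow (rayA η), mul_pow rayB, rayA_sq hη,
    rayB_sq, rayA, rayB]
  ring_nf

lemma hasDerivAt_exp_neg_mul_ofReal_sq (k : ℂ) (x : ℝ) :
    HasDerivAt (fun x : ℝ => Complex.exp (-(k * x) ^ 2))
      (Complex.exp (-(k * x) ^ 2) * (-(2 * k ^ 2 * x))) x := by
  have h1 : HasDerivAt (fun x : ℝ => k * (x : ℂ)) k x := by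
    simpa using (Complex.ofRealCLM.hasDerivAt (x := x)).const_mul k
  have h : HasDerivAt (fun x : ℝ => Complex.exp (-(k * x) ^ 2)) _ x := (h1.pow 2).neg.cexp
  refine h.congr_deriv ?_
  simp only [Pi.neg_apply, Pi.pow_apply]
  push_cast
  ring

lemma hasDerivAt_taufun {η : ℝ} (hη : 0 < η) (a : ℕ) (ξ : ℝ) :
    HasDerivAt (taufun a η) (tauDeriv a η ξ) ξ := by
  have hπ : (Real.sqrt Real.pi : ℂ) ≠ 0 := by
    exact_mod_cast (Real.sqrt_pos.2 Real.pi_pos).ne'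
  have hs : (Real.sqrt η : ℂ) ≠ 0 := by exact_mod_cast (Real.sqrt_pos.2 hη).ne'
  have hs2 : (η : ℂ) = (Real.sqrt η : ℂ) ^ 2 := by
    rw [← Complex.ofReal_pow, Real.sq_sqrt hη.le]
  have hid : HasDerivAt (fun x : ℝ => (x : ℂ)) 1 ξ := Complex.ofRealCLM.hasDerivAt
  have h := ((((hasDerivAt_exp_neg_mul_ofReal_sq (rayA η) ξ).const_mul
      (Complex.exp (Complex.I * (Real.pi / 4)))).const_mul
        (2 * Real.sqrt η / Real.sqrt Real.pi : ℂ)).add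
      (hid.mul (hasDerivAt_cerf_mul_ofReal (rayA η) ξ))).add
    (((hasDerivAt_exp_neg_mul_ofReal_sq rayB ξ).const_mul
      (Complex.exp (-(Complex.I * (Real.pi / 4))))).const_mul
        (2 * ((a : ℂ) - 1) / Real.sqrt Real.pi)) |>.add
    ((hid.mul_const ((a : ℂ) - 1)).mul (hasDerivAt_cerf_mul_ofReal rayB ξ))
  have hf : taufun a η = _ := funext (taufun_eq hη a)
  rw [hf]
  refine h.congr_deriv ?_
  rw [rayA_sq hη, rayB_sq, tauDeriv]
  set E := Complex.exp (-(rayA η * ξ) ^ 2)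
  set D := Complex.exp (-(rayB * ξ) ^ 2)
  have hA : rayA η = (Real.sqrt 2 / 2 : ℝ) * (1 - Complex.I) / (2 * Real.sqrt η) := by
    rw [rayA, exp_neg_I_mul_pi_div_four]
  have hB : rayB = (Real.sqrt 2 / 2 : ℝ) * (1 + Complex.I) / 2 := by
    rw [rayB, exp_I_mul_pi_div_four]
  have cA : 2 * Real.sqrt η / Real.sqrt Real.pi *
      (Complex.exp (Complex.I * (Real.pi / 4)) * (E * (-(2 * -(Complex.I / (4 * η)) * ξ))))
      + ξ * (2 / Real.sqrt Real.pi * (rayA η * E)) = 0 := by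
    rw [hA, exp_I_mul_pi_div_four, hs2]
    field_simp
    linear_combination (4 * (Real.sqrt 2 / 2 : ℝ) * ξ * E : ℂ) * Complex.I_sq
  have cB : 2 * ((a : ℂ) - 1) / Real.sqrt Real.pi *
      (Complex.exp (-(Complex.I * (Real.pi / 4))) * (D * (-(2 * (Complex.I / 4) * ξ))))
      + ξ * ((a : ℂ) - 1) * (2 / Real.sqrt Real.pi * (rayB * D)) = 0 := by
    rw [hB, exp_neg_I_mul_pi_div_four]
    field_simp
    linear_combination (4 * (Real.sqrt 2 / 2 : ℝ) * ξ * ((a : ℂ) - 1) * D : ℂ) * Complex.I_sq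
  linear_combination cA + cB

lemma hasDerivAt_tauDeriv {η : ℝ} (hη : 0 < η) (a : ℕ) (ξ : ℝ) :
    HasDerivAt (tauDeriv a η) (Pfun a η ξ) ξ := by
  rw [Pfun_eq hη]
  exact (hasDerivAt_cerf_mul_ofReal _ ξ).add ((hasDerivAt_cerf_mul_ofReal _ ξ).const_mul _)

lemma tendsto_tauDeriv_atTop {η : ℝ} (hη : 0 < η) (a : ℕ) :
    Tendsto (tauDeriv a η) atTop (𝓝 a) := by
  have h := (tendsto_cerf_mul_ofReal_atTop (rayA_re_pos hη) (rayA_sq_re hη)).add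
    ((tendsto_cerf_mul_ofReal_atTop rayB_re_pos rayB_sq_re).const_mul ((a : ℂ) - 1))
  rwa [mul_one, add_sub_cancel] at h

lemma continuous_Pfun (a : ℕ) (η : ℝ) : Continuous (Pfun a η) := by
  unfold Pfun
  fun_prop

lemma continuous_taufun {η : ℝ} (hη : 0 < η) (a : ℕ) : Continuous (taufun a η) :=
  continuous_iff_continuousAt.2 fun ξ => (hasDerivAt_taufun hη a ξ).continuousAt

lemma tauDeriv_re_nonneg {a : ℕ} (ha : 1 ≤ a) {η : ℝ} (hη : 0 < η) {ξ : ℝ} (hξ : 0 ≤ ξ) :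
    0 ≤ (tauDeriv a η ξ).re := by
  obtain ⟨b, rfl⟩ := Nat.exists_eq_add_of_le' ha
  have h1 := cerf_mul_ofReal_re_nonneg (rayA_re_pos hη).le (rayA_sq_re hη) hξ
  have h2 := cerf_mul_ofReal_re_nonneg rayB_re_pos.le rayB_sq_re hξ
  have e : tauDeriv (b + 1) η ξ = cerf (rayA η * ξ) + ((b : ℝ) : ℂ) * cerf (rayB * ξ) := by
    rw [tauDeriv]
    push_cast
    ring
  rw [e, Complex.add_re, Complex.re_ofReal_mul]
  positivity

lemma taufun_zero_re_pos {a : ℕ} (ha : 1 ≤ a) {η : ℝ} (hη : 0 < η) :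
    0 < (taufun a η 0).re := by
  obtain ⟨b, rfl⟩ := Nat.exists_eq_add_of_le' ha
  have e : taufun (b + 1) η 0 =
      ((2 * Real.sqrt η / Real.sqrt Real.pi * (Real.sqrt 2 / 2) : ℝ) : ℂ) * (1 + Complex.I)
      + ((2 * b / Real.sqrt Real.pi * (Real.sqrt 2 / 2) : ℝ) : ℂ) * (1 - Complex.I) := by
    rw [taufun_eq hη, exp_I_mul_pi_div_four, exp_neg_I_mul_pi_div_four]
    simp
    ring
  rw [e, Complex.add_re, Complex.re_ofReal_mul, Complex.re_ofReal_mul]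
  simp only [Complex.add_re, Complex.sub_re, Complex.one_re, Complex.I_re, add_zero, sub_zero,
    mul_one]
  have := Real.pi_pos
  positivity

lemma exists_le_taufun_re {a : ℕ} (ha : 1 ≤ a) {η : ℝ} (hη : 0 < η) :
    ∃ c : ℝ, 0 < c ∧ ∀ ξ : ℝ, 0 ≤ ξ → c * (ξ + 1) ≤ (taufun a η ξ).re := by
  have hd : ∀ ξ, HasDerivAt (fun ξ => (taufun a η ξ).re) (tauDeriv a η ξ).re ξ := fun ξ =>
    Complex.reCLM.hasFDerivAt.comp_hasDerivAt ξ (hasDerivAt_taufun hη a ξ)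
  have hdiff : Differentiable ℝ fun ξ => (taufun a η ξ).re := fun ξ => (hd ξ).differentiableAt
  have hlim : Tendsto (fun ξ => (tauDeriv a η ξ).re) atTop (𝓝 (a : ℝ)) := by
    exact (Complex.continuous_re.tendsto _).comp (tendsto_tauDeriv_atTop hη a)
  have ha' : (1 / 2 : ℝ) < a := by
    have : (1 : ℝ) ≤ a := by exact_mod_cast ha
    linarith
  obtain ⟨x, hx0, hx⟩ : ∃ x : ℝ, 0 ≤ x ∧ ∀ ξ, x ≤ ξ → 1 / 2 ≤ (tauDeriv a η ξ).re := by
    obtain ⟨x, hx⟩ := eventually_atTop.1 (hlim.eventually (lt_mem_nhds ha'))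
    exact ⟨max x 0, le_max_right _ _, fun ξ h => (hx ξ ((le_max_left _ _).trans h)).le⟩
  have h0 := taufun_zero_re_pos ha hη
  set t := (taufun a η 0).re
  have mono : ∀ ξ, 0 ≤ ξ → t ≤ (taufun a η ξ).re := fun ξ hξ => by
    refine monotoneOn_of_deriv_nonneg (convex_Ici 0) hdiff.continuous.continuousOn
      hdiff.differentiableOn (fun y hy => ?_) Set.self_mem_Ici hξ hξ
    rw [(hd y).deriv]
    exact tauDeriv_re_nonneg ha hη (interior_subset hy)
  have grow : ∀ ξ, x ≤ ξ → 1 / 2 * (ξ - x) ≤ (taufun a η ξ).re - (taufun a η x).re :=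
    fun ξ hξ => by
    refine Convex.mul_sub_le_image_sub_of_le_deriv (convex_Ici x) hdiff.continuous.continuousOn
      hdiff.differentiableOn (fun y hy => ?_) x Set.self_mem_Ici ξ hξ hξ
    rw [(hd y).deriv]
    exact hx y (interior_subset hy)
  refine ⟨min (t / (x + 1)) (1 / 2), by positivity, fun ξ hξ => ?_⟩
  set c := min (t / (x + 1)) (1 / 2)
  have hc : 0 ≤ c := by positivity
  have h1 : c * (x + 1) ≤ t := (le_div_iff₀ (by linarith)).1 (min_le_left _ _)
  have h2 : c ≤ 1 / 2 := min_le_right _ _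
  rcases le_total ξ x with h | h
  · nlinarith [mono ξ hξ]
  · nlinarith [mono x hx0, grow ξ h]

lemma exists_norm_Pfun_le (a : ℕ) (η : ℝ) : ∃ M : ℝ, ∀ ξ, ‖Pfun a η ξ‖ ≤ M := by
  refine ⟨‖(Real.sqrt (Real.pi * η) : ℂ)⁻¹‖ + ‖((a : ℂ) - 1) / (Real.sqrt Real.pi : ℂ)‖,
    fun ξ => ?_⟩
  have h : ∀ r : ℝ, ‖Complex.exp (Complex.I * r)‖ = 1 := fun r => by
    rw [mul_comm, Complex.norm_exp_ofReal_mul_I]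
  refine (norm_add_le _ _).trans_eq ?_
  have h1 := h (ξ ^ 2 / (4 * η) - Real.pi / 4)
  have h2 := h (Real.pi / 4 - ξ ^ 2 / 4)
  push_cast at h1 h2
  rw [norm_mul, norm_mul, h1, h2, mul_one, mul_one]

lemma integrableOn_exp_neg_mul_sqrt {b : ℝ} (hb : 0 < b) :
    MeasureTheory.IntegrableOn (fun β : ℝ => Real.exp (-b * Real.sqrt β)) (Set.Ioi 0) := by
  have := integrableOn_rpow_mul_exp_neg_mul_rpow (s := 0) (p := 1 / 2) (by norm_num)
    (by norm_num) hb
  simpa [Real.sqrt_eq_rpow] using this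

lemma integral_exp_neg_mul_sqrt {b : ℝ} (hb : 0 < b) :
    ∫ β in Set.Ioi (0:ℝ), Real.exp (-b * Real.sqrt β) = b ^ (-2 : ℝ) * Real.Gamma 3 := by
  have := integral_exp_neg_mul_rpow (p := 1 / 2) (by norm_num) hb
  norm_num at this
  simpa [Real.sqrt_eq_rpow] using this

lemma integrable_exp_neg_mul_add_one_mul_sqrt {c : ℝ} (hc : 0 < c) :
    MeasureTheory.Integrable (fun p : ℝ × ℝ => Real.exp (-(c * (p.1 + 1)) * Real.sqrt p.2))
      ((MeasureTheory.volume.restrict (Set.Ioi 0)).prod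
        (MeasureTheory.volume.restrict (Set.Ioi 0))) := by
  have hcont : Continuous fun p : ℝ × ℝ => Real.exp (-(c * (p.1 + 1)) * Real.sqrt p.2) := by
    fun_prop
  have hpos : ∀ ξ ∈ Set.Ioi (0:ℝ), 0 < c * (ξ + 1) := fun ξ hξ =>
    mul_pos hc (by linarith [Set.mem_Ioi.1 hξ])
  refine (MeasureTheory.integrable_prod_iff hcont.aestronglyMeasurable).2 ⟨?_, ?_⟩
  · refine (MeasureTheory.ae_restrict_iff' measurableSet_Ioi).2 (.of_forall fun ξ hξ => ?_)
    exact integrableOn_exp_neg_mul_sqrt (hpos ξ hξ)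
  · have h : MeasureTheory.IntegrableOn
        (fun ξ : ℝ => c ^ (-2 : ℝ) * Real.Gamma 3 * (ξ + 1) ^ (-2 : ℝ)) (Set.Ioi 0) :=
      (integrableOn_add_rpow_Ioi_of_lt (by norm_num) (by norm_num)).const_mul _
    refine h.congr_fun (fun ξ hξ => ?_) measurableSet_Ioi
    simp only [Real.norm_eq_abs, Real.abs_exp]
    rw [integral_exp_neg_mul_sqrt (hpos ξ hξ),
      Real.mul_rpow hc.le (by linarith [Set.mem_Ioi.1 hξ])]
    ring

/-- Exchange of the order of integration for the full improper double integral: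
`∫_0^∞ [∫_0^∞ P_η(ξ) e^{−√β τ_η(ξ) − iσβ} dξ] dβ = ∫_0^∞ [∫_0^∞ ⋯ dβ] dξ`,
all improper integrals over `(0, ∞)` being limits of integrals over `(0, X)`. -/
theorem exchange_order_infinite
    (a : ℕ) (ha : 1 ≤ a) (η : ℝ) (hη : 0 < η) (σ : ℝ) (hσ : σ ≤ 0) :
    ∃ (G H : ℝ → ℂ) (J : ℂ),
      (∀ β : ℝ, 0 ≤ β → Tendsto
        (fun X : ℝ => ∫ ξ in (0:ℝ)..X, Pfun a η ξ *
          Complex.exp (-(Real.sqrt β : ℂ) * taufun a η ξ - Complex.I * σ * β))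
        atTop (𝓝 (G β))) ∧
      (∀ ξ : ℝ, 0 ≤ ξ → Tendsto
        (fun B : ℝ => ∫ β in (0:ℝ)..B, Pfun a η ξ *
          Complex.exp (-(Real.sqrt β : ℂ) * taufun a η ξ - Complex.I * σ * β))
        atTop (𝓝 (H ξ))) ∧
      Tendsto (fun B : ℝ => ∫ β in (0:ℝ)..B, G β) atTop (𝓝 J) ∧
      Tendsto (fun X : ℝ => ∫ ξ in (0:ℝ)..X, H ξ) atTop (𝓝 J) := by
  obtain ⟨c, hc, hτ⟩ := exists_le_taufun_re ha hη
  obtain ⟨M, hM⟩ := exists_norm_Pfun_le a η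
  have hM0 : 0 ≤ M := (norm_nonneg _).trans (hM 0)
  set f : ℝ → ℝ → ℂ := fun ξ β => Pfun a η ξ *
    Complex.exp (-(Real.sqrt β : ℂ) * taufun a η ξ - Complex.I * σ * β) with hf
  have hfc : Continuous (Function.uncurry f) := by
    have h1 : Continuous fun p : ℝ × ℝ => Pfun a η p.1 :=
      (continuous_Pfun a η).comp continuous_fst
    have h2 : Continuous fun p : ℝ × ℝ => taufun a η p.1 :=
      (continuous_taufun hη a).comp continuous_fst
    have h3 : Continuous fun p : ℝ × ℝ => (Real.sqrt p.2 : ℂ) := by fun_prop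
    exact h1.mul (((h3.neg.mul h2).sub (by fun_prop)).cexp)
  have hbound : ∀ ξ β : ℝ, 0 ≤ ξ →
      ‖f ξ β‖ ≤ M * Real.exp (-(c * (ξ + 1)) * Real.sqrt β) := fun ξ β hξ => by
    rw [hf, norm_mul, Complex.norm_exp]
    refine mul_le_mul (hM ξ) (Real.exp_le_exp.2 ?_) (Real.exp_pos _).le hM0
    have e : (-(Real.sqrt β : ℂ) * taufun a η ξ - Complex.I * σ * β).re
        = -(Real.sqrt β * (taufun a η ξ).re) := by
      simp
    rw [e]
    nlinarith [mul_le_mul_of_nonneg_left (hτ ξ hξ) (Real.sqrt_nonneg β)]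
  have hint : MeasureTheory.Integrable (Function.uncurry f)
      ((MeasureTheory.volume.restrict (Set.Ioi 0)).prod
        (MeasureTheory.volume.restrict (Set.Ioi 0))) := by
    refine ((integrable_exp_neg_mul_add_one_mul_sqrt hc).const_mul M).mono'
      hfc.aestronglyMeasurable ?_
    rw [MeasureTheory.Measure.prod_restrict]
    refine (MeasureTheory.ae_restrict_iff' (measurableSet_Ioi.prod measurableSet_Ioi)).2
      (.of_forall fun p hp => hbound p.1 p.2 (le_of_lt hp.1))
  have hint_beta : ∀ ξ : ℝ, 0 ≤ ξ → MeasureTheory.IntegrableOn (f ξ) (Set.Ioi 0) :=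
    fun ξ hξ => by
    refine ((integrableOn_exp_neg_mul_sqrt (b := c * (ξ + 1)) (by positivity)).const_mul M).mono'
      (hfc.comp (by fun_prop : Continuous fun β : ℝ => (ξ, β))).aestronglyMeasurable
      (.of_forall fun β => hbound ξ β hξ)
  have hint_xi : ∀ β : ℝ, 0 < β →
      MeasureTheory.IntegrableOn (fun ξ => f ξ β) (Set.Ioi 0) := fun β hβ => by
    have hb : -(c * Real.sqrt β) < 0 := neg_lt_zero.2 (mul_pos hc (Real.sqrt_pos.2 hβ))
    refine ((integrableOn_exp_mul_Ioi hb 0).const_mul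
      (M * Real.exp (-(c * Real.sqrt β)))).mono'
      (hfc.comp (by fun_prop : Continuous fun ξ : ℝ => (ξ, β))).aestronglyMeasurable
      ((MeasureTheory.ae_restrict_iff' measurableSet_Ioi).2 (.of_forall fun ξ hξ => ?_))
    refine (hbound ξ β (le_of_lt hξ)).trans_eq ?_
    rw [mul_assoc, ← Real.exp_add]
    ring_nf
  refine ⟨fun β => if β = 0 then a - tauDeriv a η 0 else ∫ ξ in Set.Ioi (0:ℝ), f ξ β,
    fun ξ => ∫ β in Set.Ioi (0:ℝ), f ξ β,
    ∫ ξ in Set.Ioi (0:ℝ), ∫ β in Set.Ioi (0:ℝ), f ξ β, fun β hβ => ?_, fun ξ hξ => ?_, ?_, ?_⟩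
  · rcases hβ.eq_or_lt with rfl | hβ
    · simp only [if_true, Real.sqrt_zero, Complex.ofReal_zero, neg_zero, zero_mul, mul_zero,
        sub_zero, Complex.exp_zero, mul_one]
      refine ((tendsto_tauDeriv_atTop hη a).sub_const (tauDeriv a η 0)).congr fun X => ?_
      exact (intervalIntegral.integral_eq_sub_of_hasDerivAt
        (fun x _ => hasDerivAt_tauDeriv hη a x)
        ((continuous_Pfun a η).intervalIntegrable _ _)).symm
    · beta_reduce
      rw [if_neg hβ.ne']
      exact MeasureTheory.intervalIntegral_tendsto_integral_Ioi 0 (hint_xi β hβ) tendsto_id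
  · exact MeasureTheory.intervalIntegral_tendsto_integral_Ioi 0 (hint_beta ξ hξ) tendsto_id
  · have hG : Set.EqOn (fun β => ∫ ξ in Set.Ioi (0:ℝ), f ξ β)
        (fun β => if β = 0 then a - tauDeriv a η 0 else ∫ ξ in Set.Ioi (0:ℝ), f ξ β)
        (Set.Ioi 0) := fun β hβ => (if_neg (ne_of_gt hβ)).symm
    rw [MeasureTheory.integral_integral_swap hint,
      MeasureTheory.setIntegral_congr_fun measurableSet_Ioi hG]
    have hGint : MeasureTheory.IntegrableOn (fun β => ∫ ξ in Set.Ioi (0:ℝ), f ξ β)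
        (Set.Ioi 0) := hint.integral_prod_right
    exact MeasureTheory.intervalIntegral_tendsto_integral_Ioi 0
      (hGint.congr_fun hG measurableSet_Ioi) tendsto_id
  · have hHint : MeasureTheory.IntegrableOn (fun ξ => ∫ β in Set.Ioi (0:ℝ), f ξ β)
        (Set.Ioi 0) := hint.integral_prod_left
    exact MeasureTheory.intervalIntegral_tendsto_integral_Ioi 0 hHint tendsto_id
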